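/- arXiv:1110.4291 — 2 statements merged into one kernel-verified Lean document; each statement's English description precedes it below -/
import Mathlib

section
/- Let d ≥ 1, h > 0, R > 0. Let u⁰ : ℝ^d → ℝ be continuous and semiconcave with constant C₀ ≥ 0, and for each n ∈ ℕ let gₙ : ℝ^d × ℝ^d → ℝ be continuous, with x ↦ gₙ(x,ξ) semiconcave with constant C_g ≥ 0 for every ξ (uniformly in ξ and n). Define recursively u^{n+1}(x) = inf_{|ξ| ≤ R} ( u^n(x − hξ) + h·gₙ(x,ξ) ). Then for every n ∈ ℕ, u^n is semiconcave with constant C₀ + n·h·C_g; that is, u^n(x+y) − 2u^n(x) + u^n(x−y) ≤ (C₀ + n·h·C_g)|y|² for all x, y ∈ ℝ^d. -/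
/-- Propagation of semiconcavity by the semi-Lagrangian scheme:
if u⁰ is semiconcave with constant C₀ and each gₙ(·,ξ) is semiconcave with constant C_g
uniformly in ξ and n, then the iterates uⁿ are semiconcave with constant C₀ + n h C_g. -/
theorem stmt8 (d : ℕ) (hd : 1 ≤ d) (h R : ℝ) (hh : 0 < h) (hR : 0 < R)
    (u₀ : EuclideanSpace ℝ (Fin d) → ℝ) (hu₀cont : Continuous u₀)
    (C₀ : ℝ) (hC₀ : 0 ≤ C₀)
    (hu₀conc : ∀ x y : EuclideanSpace ℝ (Fin d),
      u₀ (x + y) - 2 * u₀ x + u₀ (x - y) ≤ C₀ * ‖y‖ ^ 2)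
    (g : ℕ → EuclideanSpace ℝ (Fin d) → EuclideanSpace ℝ (Fin d) → ℝ)
    (hgcont : ∀ n, Continuous (fun q : EuclideanSpace ℝ (Fin d) × EuclideanSpace ℝ (Fin d)
      => g n q.1 q.2))
    (Cg : ℝ) (hCg : 0 ≤ Cg)
    (hgconc : ∀ n (ξ x y : EuclideanSpace ℝ (Fin d)),
      g n (x + y) ξ - 2 * g n x ξ + g n (x - y) ξ ≤ Cg * ‖y‖ ^ 2)
    (u : ℕ → EuclideanSpace ℝ (Fin d) → ℝ)
    (hinit : u 0 = u₀)
    (hrec : ∀ n x, u (n + 1) x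
      = sInf ((fun ξ => u n (x - h • ξ) + h * g n x ξ) '' Metric.closedBall 0 R)) :
    ∀ (n : ℕ) (x y : EuclideanSpace ℝ (Fin d)),
      u n (x + y) - 2 * u n x + u n (x - y) ≤ (C₀ + n * h * Cg) * ‖y‖ ^ 2 := by
  have hK : IsCompact (Metric.closedBall (0 : EuclideanSpace ℝ (Fin d)) R) :=
    isCompact_closedBall 0 R
  have hne : (Metric.closedBall (0 : EuclideanSpace ℝ (Fin d)) R).Nonempty :=
    ⟨0, Metric.mem_closedBall_self hR.le⟩
  have hjoint : ∀ n, Continuous (u n) → Continuous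
      (fun q : EuclideanSpace ℝ (Fin d) × EuclideanSpace ℝ (Fin d) =>
        u n (q.1 - h • q.2) + h * g n q.1 q.2) := by
    intro n hn
    exact (hn.comp (by fun_prop)).add (continuous_const.mul (hgcont n))
  have hcont : ∀ n, Continuous (u n) := by
    intro n
    induction n with
    | zero => rw [hinit]; exact hu₀cont
    | succ n ih =>
      have e : u (n + 1) = fun x =>
          sInf ((fun ξ => u n (x - h • ξ) + h * g n x ξ) '' Metric.closedBall 0 R) :=
        funext (hrec n)
      rw [e]
      exact hK.continuous_sInf (f := fun x ξ => u n (x - h • ξ) + h * g n x ξ)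
        (hjoint n ih)
  have hsec : ∀ n x, Continuous (fun ξ => u n (x - h • ξ) + h * g n x ξ) := fun n x =>
    (hjoint n (hcont n)).comp (f := fun ξ => (x, ξ)) (by fun_prop)
  have hle : ∀ n x, ∀ ξ ∈ Metric.closedBall (0 : EuclideanSpace ℝ (Fin d)) R,
      u (n + 1) x ≤ u n (x - h • ξ) + h * g n x ξ := by
    intro n x ξ hξ
    rw [hrec]
    exact csInf_le (hK.image (hsec n x)).bddBelow ⟨ξ, hξ, rfl⟩
  intro n
  induction n with
  | zero => intro x y; simpa [hinit] using hu₀conc x y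
  | succ n ih =>
    intro x y
    obtain ⟨ξ, hξ, e⟩ := (hK.image (hsec n x)).sInf_mem (hne.image _)
    rw [← hrec] at e
    have h1 := hle n (x + y) ξ hξ
    have h2 := hle n (x - y) ξ hξ
    have h3 := ih (x - h • ξ) y
    have h4 := mul_le_mul_of_nonneg_left (hgconc n ξ x y) hh.le
    rw [show x - h • ξ + y = x + y - h • ξ by abel,
      show x - h • ξ - y = x - y - h • ξ by abel] at h3
    simp only at e
    push_cast
    linarith
end

section
/- Let β ≥ 0, Λ ≥ 0, L ≥ 0. Let u : ℝ → ℝ be differentiable and semiconcave with constant β, i.e. u(x+y) − 2u(x) + u(x−y) ≤ β y² for all x, y ∈ ℝ. Let a : ℝ × ℝ → ℝ be such that for each x the map p ↦ a(x,p) is differentiable with 0 ≤ ∂_p a(x,p) ≤ Λ for all x, p, and such that (a(x,p) − a(y,p))·(x − y) ≤ L(x − y)² for all x, y, p ∈ ℝ. Then the composed field x ↦ a(x, u'(x)) satisfies the one-sided Lipschitz condition with constant Λβ + L: ( a(x,u'(x)) − a(y,u'(y)) )·(x − y) ≤ (Λβ + L)(x − y)² for all x, y ∈ ℝ. -/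
theorem aux_step (β : ℝ) (u : ℝ → ℝ)
    (hconc : ∀ x y : ℝ, u (x + y) - 2 * u x + u (x - y) ≤ β * y ^ 2) (y h : ℝ) (k : ℕ) :
    u (y + k * h + h) - u (y + k * h) ≤ u (y + h) - u y + k * (β * h ^ 2) := by
  induction k with
  | zero => simp
  | succ k ih =>
    have := hconc (y + k * h + h) h
    have e : y + ((k + 1 : ℕ) : ℝ) * h = y + k * h + h := by push_cast; ring
    rw [e]
    rw [add_sub_cancel_right] at this
    push_cast
    linarith

theorem aux_deriv (β : ℝ) (u : ℝ → ℝ) (hu : Differentiable ℝ u)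
    (hconc : ∀ x y : ℝ, u (x + y) - 2 * u x + u (x - y) ≤ β * y ^ 2) (x y : ℝ) (hxy : y < x) :
    deriv u x - deriv u y ≤ β * (x - y) := by
  have hd : 0 < x - y := sub_pos.2 hxy
  have hlim : Filter.Tendsto (fun n : ℕ => (x - y) * (1 / ((n : ℝ) + 1))) Filter.atTop
      (nhdsWithin 0 (Set.Ioi 0)) := by
    rw [tendsto_nhdsWithin_iff]
    constructor
    · simpa using (tendsto_one_div_add_atTop_nhds_zero_nat (𝕜 := ℝ)).const_mul (x - y)
    · refine Filter.Eventually.of_forall fun n => ?_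
      simp only [Set.mem_Ioi]
      positivity
  have hx := (hu x).hasDerivAt.tendsto_slope_zero_right.comp hlim
  have hy := (hu y).hasDerivAt.tendsto_slope_zero_right.comp hlim
  refine le_of_tendsto (hx.sub hy) (Filter.Eventually.of_forall fun n => ?_)
  simp only [Function.comp, smul_eq_mul]
  have hn : (0 : ℝ) < (n : ℝ) + 1 := by positivity
  obtain ⟨h, hh⟩ : ∃ h, h = (x - y) * (1 / ((n : ℝ) + 1)) := ⟨_, rfl⟩
  rw [← hh]
  have hpos : 0 < h := by rw [hh]; positivity
  have e : ((n : ℝ) + 1) * h = x - y := by rw [hh]; field_simp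
  have key := aux_step β u hconc y h (n + 1)
  push_cast at key
  rw [e, add_sub_cancel] at key
  rw [← mul_sub, inv_mul_le_iff₀ hpos]
  have e2 : ((n : ℝ) + 1) * (β * h ^ 2) = h * (β * (x - y)) := by rw [← e]; ring
  linarith

theorem aux_main (β Λ L : ℝ) (hβ : 0 ≤ β) (hΛ : 0 ≤ Λ)
    (u : ℝ → ℝ) (hu : Differentiable ℝ u)
    (hconc : ∀ x y : ℝ, u (x + y) - 2 * u x + u (x - y) ≤ β * y ^ 2)
    (a : ℝ → ℝ → ℝ)
    (ha : ∀ x, Differentiable ℝ (a x))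
    (hap : ∀ x p : ℝ, 0 ≤ deriv (a x) p ∧ deriv (a x) p ≤ Λ)
    (haOSL : ∀ x y p : ℝ, (a x p - a y p) * (x - y) ≤ L * (x - y) ^ 2)
    (x y : ℝ) (hxy : y < x) :
    (a x (deriv u x) - a y (deriv u y)) * (x - y) ≤ (Λ * β + L) * (x - y) ^ 2 := by
  have hd : 0 < x - y := sub_pos.2 hxy
  have h1 := aux_deriv β u hu hconc x y hxy
  have h2 := haOSL x y (deriv u y)
  have h3 : a x (deriv u x) - a x (deriv u y) ≤ Λ * (β * (x - y)) := by
    rcases le_total (deriv u x) (deriv u y) with h | h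
    · have := monotone_of_deriv_nonneg (ha x) (fun p => (hap x p).1) h
      have : 0 ≤ Λ * (β * (x - y)) := by positivity
      linarith
    · have := image_sub_le_mul_sub_of_deriv_le (ha x) (fun p => (hap x p).2) h
      exact this.trans (mul_le_mul_of_nonneg_left h1 hΛ)
  have h4 := mul_le_mul_of_nonneg_right h3 hd.le
  linarith

/-- In one dimension, if u is differentiable and semiconcave with constant β and
a(x,p) is differentiable in p with 0 ≤ ∂_p a ≤ Λ and one-sided Lipschitz in x with constant L,
then x ↦ a(x, u'(x)) satisfies the one-sided Lipschitz condition with constant Λβ + L. -/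
theorem stmt19 (β Λ L : ℝ) (hβ : 0 ≤ β) (hΛ : 0 ≤ Λ) (hL : 0 ≤ L)
    (u : ℝ → ℝ) (hu : Differentiable ℝ u)
    (hconc : ∀ x y : ℝ, u (x + y) - 2 * u x + u (x - y) ≤ β * y ^ 2)
    (a : ℝ → ℝ → ℝ)
    (ha : ∀ x, Differentiable ℝ (a x))
    (hap : ∀ x p : ℝ, 0 ≤ deriv (a x) p ∧ deriv (a x) p ≤ Λ)
    (haOSL : ∀ x y p : ℝ, (a x p - a y p) * (x - y) ≤ L * (x - y) ^ 2) :
    ∀ x y : ℝ,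
      (a x (deriv u x) - a y (deriv u y)) * (x - y) ≤ (Λ * β + L) * (x - y) ^ 2 := by
  intro x y
  rcases lt_trichotomy x y with h | h | h
  · have := aux_main β Λ L hβ hΛ u hu hconc a ha hap haOSL y x h
    linarith
  · subst h
    simp
  · exact aux_main β Λ L hβ hΛ u hu hconc a ha hap haOSL x y h
end
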